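/- arXiv:math/0306275 — 2 statements merged into one kernel-verified Lean document; each statement's English description precedes it below -/
import Mathlib

section
/- The quotient ring R/J has Krull dimension n² + n; that is, the scheme D⁰ = {(X,Y) : XY lower triangular, YX upper triangular} is a complete intersection, cut out by n² − n equations in the 2n²-dimensional affine space of pairs of matrices. -/
noncomputable section

/-- Pairs of `n × n` complex matrices are points of `ℂ^{2n²}`. -/
abbrev MatC (n : ℕ) := Matrix (Fin n) (Fin n) ℂ

/-- The polynomial ring `R = ℂ[x_{ij}, y_{ij}]` in `2n²` variables. -/
abbrev PolyRing (n : ℕ) := MvPolynomial ((Fin n × Fin n) ⊕ (Fin n × Fin n)) ℂ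

/-- The generic matrix `X = (x_{ij})`. -/
def Xgen (n : ℕ) : Matrix (Fin n) (Fin n) (PolyRing n) :=
  Matrix.of fun i j => MvPolynomial.X (Sum.inl (i, j))

/-- The generic matrix `Y = (y_{ij})`. -/
def Ygen (n : ℕ) : Matrix (Fin n) (Fin n) (PolyRing n) :=
  Matrix.of fun i j => MvPolynomial.X (Sum.inr (i, j))

/-- The ideal `J` generated by the strictly upper-triangular entries of `XY`
together with the strictly lower-triangular entries of `YX`. -/
def upperLowerIdeal (n : ℕ) : Ideal (PolyRing n) :=
  Ideal.span ({ f | ∃ i j : Fin n, i < j ∧ f = (Xgen n * Ygen n) i j } ∪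
              { f | ∃ i j : Fin n, j < i ∧ f = (Ygen n * Xgen n) i j })

theorem Subfield.exists_retraction {K : Type*} [Field K] (L : Subfield K) :
    ∃ φ : K →ₗ[L] L, ∀ x : L, φ (x : K) = x := by
  obtain ⟨φ, hφ⟩ := (Algebra.linearMap L K).exists_leftInverse_of_injective
    (LinearMap.ker_eq_bot.2 (algebraMap L K).injective)
  exact ⟨φ, fun x => LinearMap.congr_fun hφ x⟩

theorem Subfield.retraction_mul {K : Type*} [Field K] {L : Subfield K} (φ : K →ₗ[L] L) {a : K} (ha : a ∈ L)
    (x : K) : (φ (a * x) : K) = a * φ x := by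
  have := congrArg (Subtype.val) (φ.map_smul ⟨a, ha⟩ x)
  simpa [Subfield.smul_def] using this

/-- Some vector supported on the coordinates before `m` is sent by `X` to a vector whose first
nonzero coordinate is the `i`-th one. -/
def Matrix.HasLeadingRow {n : ℕ} {K : Type*} [Field K] (X : Matrix (Fin n) (Fin n) K) (i : Fin n)
    (m : ℕ) : Prop :=
  ∃ v : Fin n → K, (∀ k : Fin n, m ≤ k → v k = 0) ∧ (∀ k < i, X.mulVec v k = 0) ∧
    X.mulVec v i ≠ 0

namespace Matrix.HasLeadingRow

variable {n : ℕ} {K : Type*} [Field K] {X Y : Matrix (Fin n) (Fin n) K}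

theorem mono {i : Fin n} {m m' : ℕ} (hm : m ≤ m') (h : X.HasLeadingRow i m) :
    X.HasLeadingRow i m' := by
  obtain ⟨v, h0, h1, h2⟩ := h
  exact ⟨v, fun k hk => h0 k (hm.trans hk), h1, h2⟩

theorem mem_of_forall_lt (L : Subfield K) (hX : ∀ i j, X i j ∈ L) {i j : Fin n}
    (hYX : ∀ k < j, (Y * X) j k = 0) (h : X.HasLeadingRow i j)
    (hY : ∀ k, i < k → Y j k ∈ L) : Y j i ∈ L := by
  obtain ⟨v, h0, h1, h2⟩ := h
  obtain ⟨φ, hφ⟩ := L.exists_retraction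
  set w : Fin n → K := fun k => (φ ((X.mulVec v i)⁻¹ * v k) : K) with hw
  have hXw : ∀ k, X.mulVec w k = φ ((X.mulVec v i)⁻¹ * X.mulVec v k) := by
    intro k
    simp only [Matrix.mulVec, dotProduct, hw, Finset.mul_sum, map_sum]
    rw [AddSubmonoidClass.coe_finsetSum]
    refine Finset.sum_congr rfl fun l _ => ?_
    rw [← Subfield.retraction_mul φ (hX k l)]
    rw [mul_left_comm]
  have hw0 : ∀ k : Fin n, j ≤ k → w k = 0 := fun k hk => by simp [hw, h0 k hk]
  have hwi : X.mulVec w i = 1 := by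
    rw [hXw, inv_mul_cancel₀ h2]
    simpa using congrArg Subtype.val (hφ 1)
  have hwlt : ∀ k < i, X.mulVec w k = 0 := fun k hk => by rw [hXw, h1 k hk]; simp
  have hzero : ∑ k, Y j k * X.mulVec w k = 0 := by
    change Y.mulVec (X.mulVec w) j = 0
    rw [Matrix.mulVec_mulVec]
    change ∑ k, (Y * X) j k * w k = 0
    refine Finset.sum_eq_zero fun k _ => ?_
    rcases lt_or_ge k j with hk | hk
    · rw [hYX k hk, zero_mul]
    · rw [hw0 k hk, mul_zero]
  rw [← Finset.add_sum_erase _ _ (Finset.mem_univ i), hwi, mul_one] at hzero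
  rw [eq_neg_of_add_eq_zero_left hzero]
  refine L.neg_mem (L.sum_mem fun k hk => ?_)
  rcases lt_or_gt_of_ne (Finset.ne_of_mem_erase hk) with hki | hki
  · rw [hwlt k hki, mul_zero]; exact L.zero_mem
  · exact L.mul_mem (hY k hki) (by rw [hXw]; exact (φ _).2)

theorem exists_row_combination {i : Fin n} {m : ℕ} (h : ¬ X.HasLeadingRow i m) :
    ∃ u : Fin n → K, (∀ k, i ≤ k → u k = 0) ∧
      ∀ j : Fin n, j < m → X i j = ∑ k, u k * X k j := by
  classical
  let f : Fin n → (Fin n → K) →ₗ[K] K := fun k =>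
    ∑ j ∈ Finset.univ.filter (fun j : Fin n => (j : ℕ) < m), X k j • LinearMap.proj j
  have hf : ∀ k v, f k v = X.mulVec (fun j : Fin n => if (j : ℕ) < m then v j else 0) k := by
    intro k v
    simp [f, Matrix.mulVec, dotProduct, LinearMap.sum_apply, ← Finset.sum_filter]
  have hker : ⨅ k : {k // k < i}, LinearMap.ker (f k) ≤ LinearMap.ker (f i) := by
    intro v hv
    simp only [Submodule.mem_iInf, LinearMap.mem_ker] at hv ⊢
    by_contra hne
    refine h ⟨fun j : Fin n => if (j : ℕ) < m then v j else 0, fun k hk => if_neg (by omega), fun k hk => ?_, ?_⟩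
    · rw [← hf]; exact hv ⟨k, hk⟩
    · rw [← hf]; exact hne
  obtain ⟨c, hc⟩ := (Submodule.mem_span_range_iff_exists_fun K).1
    (mem_span_of_iInf_ker_le_ker hker)
  refine ⟨fun k => if hk : k < i then c ⟨k, hk⟩ else 0, fun k hk => dif_neg (not_lt.2 hk), ?_⟩
  intro j hj
  have hfj : ∀ k, f k (Pi.single j 1) = X k j := by
    intro k
    simp [f, Pi.single_apply, hj]
  rw [← hfj i, ← hc]
  simp only [LinearMap.sum_apply, LinearMap.smul_apply, hfj, smul_eq_mul]
  rw [← Fintype.sum_subtype_add_sum_subtype (fun k => k < i)]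
  have hlt : ∀ k : {k // k < i}, (k : Fin n) < i := fun k => k.2
  have hge : ∀ k : {k // ¬ k < i}, ¬ (k : Fin n) < i := fun k => k.2
  simp [hlt, hge]

theorem mem_of_not (L : Subfield K) {i j : Fin n}
    (hX : ∀ k l, k ≤ i → l ≤ j → (k, l) ≠ (i, j) → X k l ∈ L)
    (hrow : ¬ X.HasLeadingRow i (j + 1)) (hcol : ¬ X.transpose.HasLeadingRow j i) :
    X i j ∈ L := by
  obtain ⟨u, hu0, hu⟩ := exists_row_combination hrow
  obtain ⟨φ, hφ⟩ := L.exists_retraction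
  have hφu : ∀ l ≤ j, ∑ k, (φ (u k) : K) * X k l = φ (X i l) := by
    intro l hl
    rw [hu l (by omega), map_sum, AddSubmonoidClass.coe_finsetSum]
    refine Finset.sum_congr rfl fun k _ => ?_
    rcases lt_or_ge k i with hk | hk
    · have hkl : X k l ∈ L := hX k l hk.le hl fun h => hk.ne (Prod.ext_iff.1 h).1
      rw [mul_comm (u k), Subfield.retraction_mul φ hkl, mul_comm]
    · simp [hu0 k hk]
  have hd : ∀ l ≤ j, X.transpose.mulVec (fun k => u k - φ (u k)) l = X i l - φ (X i l) := by
    intro l hl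
    rw [← hφu l hl]
    conv_rhs => rw [hu l (by omega)]
    simp only [Matrix.mulVec, dotProduct, Matrix.transpose_apply]
    rw [← Finset.sum_sub_distrib]
    exact Finset.sum_congr rfl fun k _ => by ring
  have hij : X i j = φ (X i j) := by
    by_contra hne
    refine hcol ⟨fun k => u k - φ (u k), fun k hk => by simp [hu0 k hk], fun l hl => ?_, ?_⟩
    · rw [hd l hl.le, sub_eq_zero]
      have hil : X i l ∈ L := hX i l le_rfl hl.le fun h => hl.ne (Prod.ext_iff.1 h).2
      exact (congrArg Subtype.val (hφ ⟨X i l, hil⟩)).symm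
    · rw [hd j le_rfl]
      exact sub_ne_zero.2 hne
  rw [hij]
  exact (φ _).2

end Matrix.HasLeadingRow

namespace Matrix

variable {n : ℕ} {K : Type*} [Field K] (X Y : Matrix (Fin n) (Fin n) K)

/-- The positions of the entries of `X` which are not determined by the entries to the north-west
of them. -/
def freePositions : Set (Fin n × Fin n) :=
  {p | X.HasLeadingRow p.1 (p.2 + 1) ∨ X.transpose.HasLeadingRow p.2 p.1}

/-- The positions `(i, j)` for which the entry `Y j i` is not determined by `X` and the entries
of `Y` to the south-east when `XY` is lower and `YX` is upper triangular. -/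
def dualFreePositions : Set (Fin n × Fin n) :=
  {p | ¬ X.HasLeadingRow p.1 p.2 ∧ ¬ X.transpose.HasLeadingRow p.2 p.1}

theorem ncard_freePositions_add_ncard_dualFreePositions_le :
    X.freePositions.ncard + X.dualFreePositions.ncard ≤ n ^ 2 + n := by
  let C : Set (Fin n × Fin n) :=
    {p | ¬ X.HasLeadingRow p.1 p.2 ∧ X.HasLeadingRow p.1 (p.2 + 1)}
  have hC : C.ncard ≤ n := by
    refine (Set.ncard_le_ncard_of_injOn (t := Set.univ) Prod.fst (fun _ _ => Set.mem_univ _)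
      ?_).trans_eq (by simp [Set.ncard_univ])
    rintro ⟨i, j⟩ ⟨h1, h2⟩ ⟨i', j'⟩ ⟨h3, h4⟩ (rfl : i = i')
    refine Prod.ext rfl ?_
    rcases lt_trichotomy j j' with h | h | h
    · exact absurd (h2.mono (Nat.succ_le_of_lt h)) h3
    · exact h
    · exact absurd (h4.mono (Nat.succ_le_of_lt h)) h1
  have hsub : X.freePositions ⊆ X.dualFreePositionsᶜ ∪ C := by
    rintro ⟨i, j⟩ h
    simp only [freePositions, dualFreePositions, C, Set.mem_ofPred_eq, Set.mem_union,
      Set.mem_compl_iff] at h ⊢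
    tauto
  have h1 := (Set.ncard_le_ncard hsub).trans (Set.ncard_union_le _ _)
  have h2 := Set.ncard_add_ncard_compl X.dualFreePositions
  rw [Nat.card_prod, Nat.card_fin, ← sq] at h2
  omega

variable {X Y}

theorem entries_mem_of_freePositions (L : Subfield K)
    (hX : ∀ p ∈ X.freePositions, X p.1 p.2 ∈ L) (i j : Fin n) : X i j ∈ L := by
  induction hs : (i : ℕ) + j using Nat.strong_induction_on generalizing i j with
  | _ s ih =>
    by_cases h : (i, j) ∈ X.freePositions
    · exact hX _ h
    · simp only [freePositions, Set.mem_ofPred_eq, not_or] at h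
      refine HasLeadingRow.mem_of_not L (fun k l hk hl hne => ih _ ?_ k l rfl) h.1 h.2
      simp only [Ne, Prod.mk.injEq, Fin.ext_iff] at hne
      omega

theorem entries_mem_of_dualFreePositions (L : Subfield K)
    (hXY : ∀ i j, i < j → (X * Y) i j = 0) (hYX : ∀ i j, j < i → (Y * X) i j = 0)
    (hX : ∀ i j, X i j ∈ L) (hY : ∀ p ∈ X.dualFreePositions, Y p.2 p.1 ∈ L) (i j : Fin n) :
    Y j i ∈ L := by
  induction hs : (n - i) + (n - j) using Nat.strong_induction_on generalizing i j with
  | _ s ih =>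
    by_cases h : (i, j) ∈ X.dualFreePositions
    · exact hY _ h
    · simp only [dualFreePositions, Set.mem_ofPred_eq, not_and_or, not_not] at h
      rcases h with h | h
      · exact h.mem_of_forall_lt L hX (fun k hk => hYX j k hk)
          fun k hk => ih _ (by omega) k j rfl
      · refine h.mem_of_forall_lt (Y := Y.transpose) L (X := X.transpose) (fun i j => hX j i) (fun k hk => ?_)
          fun k hk => ih _ (by omega) i k rfl
        rw [← Matrix.transpose_mul]
        exact hXY k i hk

/-- The entries of a pair `(X, Y)` with `XY` lower and `YX` upper triangular lie in a field
generated by at most `n ^ 2 + n` elements. -/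
theorem exists_finite_generators
    (hXY : ∀ i j, i < j → (X * Y) i j = 0) (hYX : ∀ i j, j < i → (Y * X) i j = 0) :
    ∃ s : Set K, s.Finite ∧ s.ncard ≤ n ^ 2 + n ∧ ∀ L : Subfield K, s ⊆ L →
      ∀ i j, X i j ∈ L ∧ Y i j ∈ L := by
  refine ⟨(fun p => X p.1 p.2) '' X.freePositions ∪ (fun p => Y p.2 p.1) '' X.dualFreePositions,
    Set.toFinite _, ?_, fun L hL i j => ?_⟩
  · have h1 := Set.ncard_image_le (f := fun p => X p.1 p.2) (Set.toFinite X.freePositions)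
    have h2 := Set.ncard_image_le (f := fun p => Y p.2 p.1) (Set.toFinite X.dualFreePositions)
    exact (Set.ncard_union_le _ _).trans
      ((add_le_add h1 h2).trans X.ncard_freePositions_add_ncard_dualFreePositions_le)
  · have hX := entries_mem_of_freePositions L fun p hp => hL (Or.inl ⟨p, hp, rfl⟩)
    exact ⟨hX i j, entries_mem_of_dualFreePositions L hXY hYX hX
      (fun p hp => hL (Or.inr ⟨p, hp, rfl⟩)) j i⟩

end Matrix

theorem AlgebraicIndependent.card_le_ncard_of_adjoin_eq_top {k K ι : Type*} [Field k] [Field K]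
    [Algebra k K] [Fintype ι] {x : ι → K} (hx : AlgebraicIndependent k x) {s : Set K}
    (hs : s.Finite) (htop : IntermediateField.adjoin k s = ⊤) : Fintype.card ι ≤ s.ncard := by
  have halg : Algebra.IsAlgebraic (Algebra.adjoin k s) K := by
    refine ⟨fun y => ?_⟩
    obtain ⟨a, ha, b, hb, rfl⟩ := IntermediateField.mem_adjoin_iff_div.1
      (htop ▸ IntermediateField.mem_top : y ∈ IntermediateField.adjoin k s)
    rw [div_eq_mul_inv]
    exact (isAlgebraic_algebraMap (A := K) (⟨a, ha⟩ : Algebra.adjoin k s)).mul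
      (isAlgebraic_algebraMap (A := K) (⟨b, hb⟩ : Algebra.adjoin k s)).inv
  have := hx.lift_cardinalMk_le_trdeg.trans
    (Cardinal.lift_le.2 (Algebra.IsAlgebraic.trdeg_le_cardinalMk k s))
  rw [← Set.cast_ncard hs] at this
  simpa using this

theorem ringKrullDim_le_of_isIntegral {A B : Type*} [CommRing A] [CommRing B] {f : A →+* B}
    (hf : f.IsIntegral) : ringKrullDim B ≤ ringKrullDim A := by
  algebraize [f]
  exact Order.krullDim_le_of_strictMono (PrimeSpectrum.comap f) fun P Q h =>
    Ideal.IsIntegral.comap_lt_comap (R := A) (I := P.asIdeal) (J := Q.asIdeal) h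

/-- If every field-valued point of an algebra `B` has coordinates in an extension generated by `N`
elements, then `B` has Krull dimension at most `N`. -/
theorem ringKrullDim_le_of_forall_prime {k B : Type*} [Field k] [CommRing B] [Algebra k B]
    [Algebra.FiniteType k B] {N : ℕ}
    (h : ∀ (P : Ideal B) [P.IsPrime], ∃ s : Set (FractionRing (B ⧸ P)), s.Finite ∧
      s.ncard ≤ N ∧ IntermediateField.adjoin k s = ⊤) :
    ringKrullDim B ≤ N := by
  nontriviality B
  obtain ⟨m, g, hinj, hint⟩ := exists_integral_inj_algHom_of_fg k B
  have hdim := ringKrullDim_le_of_isIntegral hint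
  rw [MvPolynomial.ringKrullDim_of_isNoetherianRing, ringKrullDim_eq_zero_of_field, zero_add,
    Nat.card_fin] at hdim
  refine hdim.trans (Nat.cast_le.2 ?_)
  obtain ⟨P, hP, hPg⟩ := Ideal.exists_comap_eq_of_mem_minimalPrimes_of_injective
    (f := g.toRingHom) hinj ⊥ (by simp [IsDomain.minimalPrimes_eq_singleton_bot])
  obtain ⟨s, hs, hsN, htop⟩ := h P
  let q : MvPolynomial (Fin m) k →ₐ[k] FractionRing (B ⧸ P) :=
    ((Algebra.ofId (B ⧸ P) (FractionRing (B ⧸ P))).restrictScalars k).comp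
      ((Ideal.Quotient.mkₐ k P).comp g)
  have hq : Function.Injective q := by
    rw [injective_iff_map_eq_zero]
    intro p hp
    have hp' : Ideal.Quotient.mk P (g p) = 0 :=
      (IsFractionRing.injective (B ⧸ P) (FractionRing (B ⧸ P))) (hp.trans (map_zero _).symm)
    rw [Ideal.Quotient.eq_zero_iff_mem] at hp'
    have : p ∈ P.comap g.toRingHom := hp'
    rwa [hPg] at this
  have hind : AlgebraicIndependent k fun i => q (MvPolynomial.X i) :=
    (MvPolynomial.algebraicIndependent_X (Fin m) k).map' hq
  simpa using (hind.card_le_ncard_of_adjoin_eq_top hs htop).trans hsN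

theorem Xgen_mul_Ygen_mem_upperLowerIdeal {n : ℕ} {i j : Fin n} (h : i < j) :
    (Xgen n * Ygen n) i j ∈ upperLowerIdeal n :=
  Ideal.subset_span (Or.inl ⟨i, j, h, rfl⟩)

theorem Ygen_mul_Xgen_mem_upperLowerIdeal {n : ℕ} {i j : Fin n} (h : j < i) :
    (Ygen n * Xgen n) i j ∈ upperLowerIdeal n :=
  Ideal.subset_span (Or.inr ⟨i, j, h, rfl⟩)

theorem ringKrullDim_quotient_upperLowerIdeal_le (n : ℕ) :
    ringKrullDim (PolyRing n ⧸ upperLowerIdeal n) ≤ (n ^ 2 + n : ℕ) := by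
  refine ringKrullDim_le_of_forall_prime (k := ℂ) fun P _ => ?_
  let K := FractionRing ((PolyRing n ⧸ upperLowerIdeal n) ⧸ P)
  let θ : PolyRing n →ₐ[ℂ] (PolyRing n ⧸ upperLowerIdeal n) ⧸ P :=
    (Ideal.Quotient.mkₐ ℂ P).comp (Ideal.Quotient.mkₐ ℂ (upperLowerIdeal n))
  have hθsurj : Function.Surjective θ :=
    Ideal.Quotient.mk_surjective.comp Ideal.Quotient.mk_surjective
  let ψ : PolyRing n →ₐ[ℂ] K :=
    ((Algebra.ofId ((PolyRing n ⧸ upperLowerIdeal n) ⧸ P) K).restrictScalars ℂ).comp θ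
  have hψ : ∀ f ∈ upperLowerIdeal n, ψ f = 0 := by
    intro f hf
    have hf' : Ideal.Quotient.mk (upperLowerIdeal n) f = 0 := Ideal.Quotient.eq_zero_iff_mem.2 hf
    change algebraMap _ K (Ideal.Quotient.mk P (Ideal.Quotient.mk (upperLowerIdeal n) f)) = 0
    rw [hf', map_zero, map_zero]
  obtain ⟨s, hs, hcard, hmem⟩ := Matrix.exists_finite_generators
    (X := (Xgen n).map ψ) (Y := (Ygen n).map ψ)
    (fun i j hij => by
      rw [← Matrix.map_mul]
      exact hψ _ (Xgen_mul_Ygen_mem_upperLowerIdeal hij))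
    (fun i j hij => by
      rw [← Matrix.map_mul]
      exact hψ _ (Ygen_mul_Xgen_mem_upperLowerIdeal hij))
  refine ⟨s, hs, hcard, eq_top_iff.2 fun y _ => ?_⟩
  have hL := hmem (IntermediateField.adjoin ℂ s).toSubfield
    (IntermediateField.subset_adjoin ℂ s)
  have hψL : ∀ f, ψ f ∈ IntermediateField.adjoin ℂ s := by
    intro f
    induction f using MvPolynomial.induction_on with
    | C a =>
      rw [← MvPolynomial.algebraMap_eq, AlgHom.commutes]
      exact IntermediateField.algebraMap_mem _ a
    | add p q hp hq => rw [map_add]; exact add_mem hp hq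
    | mul_X p v hp =>
      rw [map_mul]
      refine mul_mem hp ?_
      rcases v with ⟨i, j⟩ | ⟨i, j⟩
      · exact (hL i j).1
      · exact (hL i j).2
  obtain ⟨a, b, -, rfl⟩ := IsFractionRing.div_surjective
    (A := (PolyRing n ⧸ upperLowerIdeal n) ⧸ P) y
  obtain ⟨a, rfl⟩ := hθsurj a
  obtain ⟨b, rfl⟩ := hθsurj b
  exact div_mem (hψL a) (hψL b)

/-- Index set of the coordinates on the linear component of `D⁰` on which `X` vanishes strictly
above and the transpose of `Y` strictly below the antidiagonal. -/
abbrev AntitriangularIndex (n : ℕ) : Type :=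
  {p : Fin n × Fin n // n ≤ p.1 + p.2 + 1} ⊕ {p : Fin n × Fin n // p.1 + p.2 + 1 ≤ n}

theorem le_card_antitriangularIndex (n : ℕ) :
    n ^ 2 + n ≤ Nat.card (AntitriangularIndex n) := by
  classical
  let A := Finset.univ.filter fun p : Fin n × Fin n => n ≤ p.1 + p.2 + 1
  let B := Finset.univ.filter fun p : Fin n × Fin n => p.1 + p.2 + 1 ≤ n
  have hcard : Nat.card (AntitriangularIndex n) = A.card + B.card := by
    rw [Nat.card_eq_fintype_card, Fintype.card_sum, Fintype.card_subtype, Fintype.card_subtype]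
  have hunion : A ∪ B = Finset.univ := by
    ext p
    simp only [A, B, Finset.mem_union, Finset.mem_filter, Finset.mem_univ, true_and, iff_true]
    omega
  have hinter : n ≤ (A ∩ B).card := by
    have := Finset.card_le_card_of_injOn (s := (Finset.univ : Finset (Fin n))) (t := A ∩ B)
      (fun i => (i, i.rev)) (fun i _ => by simp [A, B, Fin.val_rev]; omega)
      (fun i _ j _ h => (Prod.ext_iff.1 h).1)
    simpa using this
  have h := Finset.card_union_add_card_inter A B
  rw [hunion, Finset.card_univ, Fintype.card_prod, Fintype.card_fin, ← sq] at h
  omega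

theorem le_ringKrullDim_quotient_upperLowerIdeal (n : ℕ) :
    (n ^ 2 + n : ℕ) ≤ ringKrullDim (PolyRing n ⧸ upperLowerIdeal n) := by
  classical
  let S := MvPolynomial (AntitriangularIndex n) ℂ
  let x : Fin n → Fin n → S := fun i j =>
    if h : n ≤ (i : ℕ) + j + 1 then MvPolynomial.X (Sum.inl ⟨(i, j), h⟩) else 0
  let y : Fin n → Fin n → S := fun i j =>
    if h : (j : ℕ) + i + 1 ≤ n then MvPolynomial.X (Sum.inr ⟨(j, i), h⟩) else 0
  let ψ : PolyRing n →ₐ[ℂ] S :=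
    MvPolynomial.aeval (Sum.elim (fun p => x p.1 p.2) fun p => y p.1 p.2)
  have hX : ∀ i j, ψ (Xgen n i j) = x i j := fun i j => by simp [ψ, Xgen]
  have hY : ∀ i j, ψ (Ygen n i j) = y i j := fun i j => by simp [ψ, Ygen]
  have hψ : ∀ f ∈ upperLowerIdeal n, ψ f = 0 := by
    change upperLowerIdeal n ≤ RingHom.ker ψ
    refine Ideal.span_le.2 ?_
    rintro f (⟨i, j, hij, rfl⟩ | ⟨i, j, hij, rfl⟩)
    all_goals
      rw [SetLike.mem_coe, RingHom.mem_ker, Matrix.mul_apply, map_sum]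
      refine Finset.sum_eq_zero fun k _ => ?_
      rw [map_mul, hX, hY]
      simp only [x, y]
      split_ifs
      · omega
      all_goals simp
  have hsurj : Function.Surjective (Ideal.Quotient.lift (upperLowerIdeal n) ψ.toRingHom hψ) := by
    refine Ideal.Quotient.lift_surjective_of_surjective _ _ ?_
    change Function.Surjective ψ
    rw [← AlgHom.range_eq_top, eq_top_iff, ← MvPolynomial.adjoin_range_X, Algebra.adjoin_le_iff]
    rintro _ ⟨⟨⟨i, j⟩, h⟩ | ⟨⟨i, j⟩, h⟩, rfl⟩
    · exact ⟨Xgen n i j, (hX i j).trans (dif_pos h)⟩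
    · exact ⟨Ygen n j i, (hY j i).trans (dif_pos h)⟩
  refine le_trans ?_ (ringKrullDim_le_of_surjective _ hsurj)
  rw [MvPolynomial.ringKrullDim_of_isNoetherianRing, ringKrullDim_eq_zero_of_field, zero_add]
  exact Nat.cast_le.2 (le_card_antitriangularIndex n)

/-- `R/J` has Krull dimension `n² + n`: the scheme
`D⁰ = {(X,Y) : XY lower triangular, YX upper triangular}` is a complete
intersection cut out by `n² - n` equations in `ℂ^{2n²}`. -/
theorem stmt4 (n : ℕ) (hn : 1 ≤ n) :
    ringKrullDim (PolyRing n ⧸ upperLowerIdeal n) = (n ^ 2 + n : ℕ) := by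
  exact le_antisymm (ringKrullDim_quotient_upperLowerIdeal_le n)
    (le_ringKrullDim_quotient_upperLowerIdeal n)
end
end

section
/- Let π ∈ Sₙ with permutation matrix P_π, and let X, Y be n×n complex matrices such that X = B₁P_πB₂ for some invertible upper triangular matrices B₁, B₂, and such that XY and YX are both upper triangular. Then for every i, the diagonal entries satisfy (XY)_{ii} = (YX)_{π(i),π(i)}. -/
noncomputable section

/-- `M` is upper triangular: `M_{ij} = 0` for `i > j`. -/
def IsUpperTri {n : ℕ} (M : MatC n) : Prop := ∀ i j : Fin n, j < i → M i j = 0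

/-- The permutation matrix `P_π`, with `(P_π)_{ij} = 1` iff `j = π(i)`. -/
def permMat {n : ℕ} (π : Equiv.Perm (Fin n)) : MatC n :=
  Matrix.of fun i j => if π i = j then 1 else 0

theorem IsUpperTri.mul_diag {n : ℕ} {A B : MatC n} (hA : IsUpperTri A) (hB : IsUpperTri B)
    (i : Fin n) : (A * B) i i = A i i * B i i := by
  rw [Matrix.mul_apply]
  refine Finset.sum_eq_single i (fun k _ hk => ?_) (by simp)
  rcases lt_or_gt_of_ne hk with h | h
  · rw [hA i k h, zero_mul]
  · rw [hB k i h, mul_zero]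

theorem IsUpperTri.mul {n : ℕ} {A B : MatC n} (hA : IsUpperTri A) (hB : IsUpperTri B) :
    IsUpperTri (A * B) := by
  intro i j hij
  rw [Matrix.mul_apply]
  refine Finset.sum_eq_zero fun k _ => ?_
  rcases lt_or_ge k i with h | h
  · rw [hA i k h, zero_mul]
  · rw [hB k j (hij.trans_le h), mul_zero]

theorem IsUpperTri.inv {n : ℕ} {A : MatC n} (hA : IsUpperTri A) (hu : IsUnit A) :
    IsUpperTri A⁻¹ := by
  have := hu.invertible
  have h : Matrix.BlockTriangular A id := fun i j hij => hA i j hij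
  exact fun i j hij => Matrix.blockTriangular_inv_of_blockTriangular h hij

/-- Conjugating by an upper triangular matrix preserves the diagonal of an upper triangular
matrix. -/
theorem IsUpperTri.conj_diag {n : ℕ} {A B N : MatC n} (hA : IsUpperTri A) (hB : IsUpperTri B)
    (hN : IsUpperTri N) (hAB : A * B = 1) (i : Fin n) : (A * N * B) i i = N i i := by
  have h : A i i * B i i = 1 := by
    rw [← hA.mul_diag hB, hAB, Matrix.one_apply_eq]
  rw [(hA.mul hN).mul_diag hB, hA.mul_diag hN, mul_right_comm, h, one_mul]

theorem permMat_mul_apply {n : ℕ} (π : Equiv.Perm (Fin n)) (Z : MatC n) (i j : Fin n) :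
    (permMat π * Z) i j = Z (π i) j := by
  simp [permMat, Matrix.mul_apply]

theorem mul_permMat_apply {n : ℕ} (π : Equiv.Perm (Fin n)) (Z : MatC n) (i j : Fin n) :
    (Z * permMat π) i (π j) = Z i j := by
  simp [permMat, Matrix.mul_apply]

/-- If `X = B₁ P_π B₂` with `B₁, B₂` invertible upper triangular, and `XY`, `YX`
are both upper triangular, then `(XY)_{ii} = (YX)_{π(i),π(i)}` for all `i`. -/
theorem stmt9 (n : ℕ) (hn : 1 ≤ n) (π : Equiv.Perm (Fin n)) (X Y B₁ B₂ : MatC n)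
    (hB₁ : IsUnit B₁) (hB₁tri : IsUpperTri B₁)
    (hB₂ : IsUnit B₂) (hB₂tri : IsUpperTri B₂)
    (hX : X = B₁ * permMat π * B₂)
    (hXY : IsUpperTri (X * Y)) (hYX : IsUpperTri (Y * X)) :
    ∀ i : Fin n, (X * Y) i i = (Y * X) (π i) (π i) := by
  intro i
  have h₁ := (Matrix.isUnit_iff_isUnit_det _).1 hB₁
  have h₂ := (Matrix.isUnit_iff_isUnit_det _).1 hB₂
  have e₁ : B₁⁻¹ * (X * Y) * B₁ = permMat π * (B₂ * Y * B₁) := by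
    simp only [hX, Matrix.mul_assoc, Matrix.nonsing_inv_mul_cancel_left _ _ h₁]
  have e₂ : B₂ * (Y * X) * B₂⁻¹ = B₂ * Y * B₁ * permMat π := by
    simp only [hX, ← Matrix.mul_assoc, Matrix.mul_nonsing_inv_cancel_right _ _ h₂]
  rw [← (hB₁tri.inv hB₁).conj_diag hB₁tri hXY (Matrix.nonsing_inv_mul _ h₁),
    ← hB₂tri.conj_diag (hB₂tri.inv hB₂) hYX (Matrix.mul_nonsing_inv _ h₂),
    e₁, e₂, permMat_mul_apply, mul_permMat_apply]
end
end
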